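/- Let 0 < α < ω₁, let X be a topological space and let E ⊆ X be an α-embedded set such that for every set A of the α'th functionally multiplicative class in X with E ∩ A = ∅, the sets E and A are α-separated. Let (A_n : n ∈ ℕ) be a partition of E by functionally ambiguous sets of class α in the subspace E. Then there exists a partition (B_n : n ∈ ℕ) of X by functionally ambiguous sets of class α in X such that A_n = E ∩ B_n for every n ∈ ℕ. -/

import Mathlib

open Set

universe u v

/-- `A` is functionally open in `X`: `A = f⁻¹((0,1])` for some continuous `f : X → [0,1]`. -/
def FunctionallyOpen (X : Type u) [TopologicalSpace X] (A : Set X) : Prop :=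
  ∃ f : X → ℝ, Continuous f ∧ (∀ x, f x ∈ Set.Icc (0:ℝ) 1) ∧ A = f ⁻¹' (Set.Ioc 0 1)

/-- `A` is functionally closed in `X`: `A = f⁻¹(0)` for some continuous `f : X → [0,1]`. -/
def FunctionallyClosed (X : Type u) [TopologicalSpace X] (A : Set X) : Prop :=
  ∃ f : X → ℝ, Continuous f ∧ (∀ x, f x ∈ Set.Icc (0:ℝ) 1) ∧ A = f ⁻¹' {0}

mutual
/-- The `α`'th functionally additive class in `X`. -/
inductive FunAdd (X : Type u) [TopologicalSpace X] : Ordinal.{0} → Set X → Prop where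
  | base (A : Set X) : FunctionallyOpen X A → FunAdd X 0 A
  | union (α : Ordinal.{0}) (hα : α ≠ 0) (β : ℕ → Ordinal.{0}) (hβ : ∀ n, β n < α)
      (s : ℕ → Set X) (hs : ∀ n, FunMul X (β n) (s n)) : FunAdd X α (⋃ n, s n)

/-- The `α`'th functionally multiplicative class in `X`. -/
inductive FunMul (X : Type u) [TopologicalSpace X] : Ordinal.{0} → Set X → Prop where
  | base (A : Set X) : FunctionallyClosed X A → FunMul X 0 A
  | inter (α : Ordinal.{0}) (hα : α ≠ 0) (β : ℕ → Ordinal.{0}) (hβ : ∀ n, β n < α)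
      (s : ℕ → Set X) (hs : ∀ n, FunAdd X (β n) (s n)) : FunMul X α (⋂ n, s n)
end

mutual
/-- The `α`'th (ordinary) additive Borel class in `X`. -/
inductive BorelAdd (X : Type u) [TopologicalSpace X] : Ordinal.{0} → Set X → Prop where
  | base (A : Set X) : IsOpen A → BorelAdd X 0 A
  | union (α : Ordinal.{0}) (hα : α ≠ 0) (β : ℕ → Ordinal.{0}) (hβ : ∀ n, β n < α)
      (s : ℕ → Set X) (hs : ∀ n, BorelMul X (β n) (s n)) : BorelAdd X α (⋃ n, s n)

/-- The `α`'th (ordinary) multiplicative Borel class in `X`. -/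
inductive BorelMul (X : Type u) [TopologicalSpace X] : Ordinal.{0} → Set X → Prop where
  | base (A : Set X) : IsClosed A → BorelMul X 0 A
  | inter (α : Ordinal.{0}) (hα : α ≠ 0) (β : ℕ → Ordinal.{0}) (hβ : ∀ n, β n < α)
      (s : ℕ → Set X) (hs : ∀ n, BorelAdd X (β n) (s n)) : BorelMul X α (⋂ n, s n)
end

/-- A set is functionally ambiguous of class `α` if it belongs to both the `α`'th functionally
additive and the `α`'th functionally multiplicative class. -/
def FunAmbiguous (X : Type u) [TopologicalSpace X] (α : Ordinal.{0}) (A : Set X) : Prop :=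
  FunAdd X α A ∧ FunMul X α A

/-- `f ∈ K_α(X,Y)`: for `α = 0` continuity, for `α > 0` preimages of open sets belong to
the `α`'th functionally additive class. -/
def KClass {X : Type u} {Y : Type v} [TopologicalSpace X] [TopologicalSpace Y]
    (α : Ordinal.{0}) (f : X → Y) : Prop :=
  (α = 0 → Continuous f) ∧ (α ≠ 0 → ∀ V : Set Y, IsOpen V → FunAdd X α (f ⁻¹' V))

/-- `A` and `B` are `α`-separated in `X`. -/
def AlphaSeparated {X : Type u} [TopologicalSpace X] (α : Ordinal.{0}) (A B : Set X) : Prop :=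
  ∃ f : X → ℝ, KClass α f ∧ A ⊆ f ⁻¹' {0} ∧ B ⊆ f ⁻¹' {1}

/-- `X` is an `α`-separated space: any two disjoint sets of the `α`'th (ordinary)
multiplicative class are `α`-separated. -/
def AlphaSeparatedSpace (X : Type u) [TopologicalSpace X] (α : Ordinal.{0}) : Prop :=
  ∀ A B : Set X, BorelMul X α A → BorelMul X α B → Disjoint A B → AlphaSeparated α A B

/-- `E` is `α`-embedded in `X`. -/
def AlphaEmbedded {X : Type u} [TopologicalSpace X] (α : Ordinal.{0}) (E : Set X) : Prop :=
  (∀ A : Set ↥E, FunAdd ↥E α A → ∃ B : Set X, FunAdd X α B ∧ Subtype.val '' A = B ∩ E) ∧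
  (∀ A : Set ↥E, FunMul ↥E α A → ∃ B : Set X, FunMul X α B ∧ Subtype.val '' A = B ∩ E)

/-- `E` is ambiguously `α`-embedded in `X`. -/
def AmbiguouslyEmbedded {X : Type u} [TopologicalSpace X] (α : Ordinal.{0}) (E : Set X) : Prop :=
  ∀ A : Set ↥E, FunAmbiguous ↥E α A →
    ∃ B : Set X, FunAmbiguous X α B ∧ Subtype.val '' A = B ∩ E

/-- The first uncountable ordinal. -/
noncomputable def omega1 : Ordinal.{0} := (Cardinal.aleph 1).ord

/-- `A` is an `F_σ`-set: a countable union of closed sets. -/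
def IsFSigma {X : Type u} [TopologicalSpace X] (A : Set X) : Prop :=
  ∃ F : ℕ → Set X, (∀ n, IsClosed (F n)) ∧ A = ⋃ n, F n

/-- A space has a countable π-base. -/
def CountablePiBase (Z : Type v) [TopologicalSpace Z] : Prop :=
  ∃ 𝒰 : Set (Set Z), 𝒰.Countable ∧ (∀ U ∈ 𝒰, IsOpen U ∧ U.Nonempty) ∧
    ∀ V : Set Z, IsOpen V → V.Nonempty → ∃ U ∈ 𝒰, U ⊆ V

theorem aux_compl {X : Type u} [TopologicalSpace X] (α : Ordinal.{0}) :
    ∀ A : Set X, (FunAdd X α A → FunMul X α Aᶜ) ∧ (FunMul X α A → FunAdd X α Aᶜ) := by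
  induction α using WellFoundedLT.induction with
  | ind α ih =>
    intro A
    constructor
    · intro h
      cases h with
      | base _ h =>
        obtain ⟨f, hc, hI, rfl⟩ := h
        refine FunMul.base _ ⟨f, hc, hI, ?_⟩
        ext x
        have := hI x
        simp only [mem_compl_iff, mem_preimage, mem_Ioc, mem_singleton_iff, mem_Icc] at *
        constructor
        · intro h; by_contra h2; exact h ⟨lt_of_le_of_ne this.1 (Ne.symm h2), this.2⟩
        · intro h h2; linarith [h2.1]
      | union _ h0 β hβ s hs =>
        rw [compl_iUnion]
        exact FunMul.inter _ h0 β hβ _ fun n => (ih _ (hβ n) _).2 (hs n)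
    · intro h
      cases h with
      | base _ h =>
        obtain ⟨f, hc, hI, rfl⟩ := h
        refine FunAdd.base _ ⟨f, hc, hI, ?_⟩
        ext x
        have := hI x
        simp only [mem_compl_iff, mem_preimage, mem_Ioc, mem_singleton_iff, mem_Icc] at *
        constructor
        · intro h; exact ⟨lt_of_le_of_ne this.1 (Ne.symm h), this.2⟩
        · intro h h2; linarith [h.1]
      | inter _ h0 β hβ s hs =>
        rw [compl_iInter]
        exact FunAdd.union _ h0 β hβ _ fun n => (ih _ (hβ n) _).1 (hs n)

theorem aux_inv {X : Type u} [TopologicalSpace X] {α : Ordinal.{0}} (h0 : α ≠ 0) {A : Set X}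
    (h : FunAdd X α A) : ∃ (β : ℕ → Ordinal.{0}) (s : ℕ → Set X), (∀ n, β n < α) ∧
      (∀ n, FunMul X (β n) (s n)) ∧ A = ⋃ n, s n := by
  cases h with
  | base _ h => exact absurd rfl h0
  | union _ h0 β hβ s hs => exact ⟨β, s, hβ, hs, rfl⟩

theorem aux_iUnion {X : Type u} [TopologicalSpace X] {α : Ordinal.{0}} (h0 : α ≠ 0)
    (A : ℕ → Set X) (h : ∀ n, FunAdd X α (A n)) : FunAdd X α (⋃ n, A n) := by
  choose β s hβ hs hA using fun n => aux_inv h0 (h n)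
  have : (⋃ n, A n) = ⋃ i : ℕ, s i.unpair.1 i.unpair.2 := by
    ext x
    simp only [hA, mem_iUnion]
    constructor
    · rintro ⟨n, k, h⟩
      exact ⟨Nat.pair n k, by simpa using h⟩
    · rintro ⟨i, h⟩
      exact ⟨_, _, h⟩
  rw [this]
  exact FunAdd.union _ h0 (fun i => β i.unpair.1 i.unpair.2) (fun i => hβ _ _) _ fun i => hs _ _

theorem aux_union {X : Type u} [TopologicalSpace X] {α : Ordinal.{0}}
    {A B : Set X} (hA : FunAdd X α A) (hB : FunAdd X α B) : FunAdd X α (A ∪ B) := by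
  by_cases h0 : α = 0
  · subst h0
    cases hA with
    | union _ h0 => exact absurd rfl h0
    | base _ hA =>
    cases hB with
    | union _ h0 => exact absurd rfl h0
    | base _ hB =>
    obtain ⟨f, hf, hfI, rfl⟩ := hA
    obtain ⟨g, hg, hgI, rfl⟩ := hB
    refine FunAdd.base _ ⟨fun x => max (f x) (g x), hf.max hg, fun x => ?_, ?_⟩
    · exact ⟨le_max_of_le_left (hfI x).1, max_le (hfI x).2 (hgI x).2⟩
    · ext x
      have h1 := (hfI x).2
      have h2 := (hgI x).2
      simp [h1, h2]
  · have : A ∪ B = ⋃ n : ℕ, if n = 0 then A else B := by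
      ext x
      simp only [mem_iUnion, mem_union]
      constructor
      · rintro (h | h)
        · exact ⟨0, by simpa using h⟩
        · exact ⟨1, by simpa using h⟩
      · rintro ⟨i, h⟩
        split_ifs at h
        · exact Or.inl h
        · exact Or.inr h
    rw [this]
    refine aux_iUnion h0 _ fun n => ?_
    split_ifs
    · exact hA
    · exact hB

theorem aux_minter {X : Type u} [TopologicalSpace X] {α : Ordinal.{0}}
    {A B : Set X} (hA : FunMul X α A) (hB : FunMul X α B) : FunMul X α (A ∩ B) := by
  have := (aux_compl α _).1 (aux_union ((aux_compl α _).2 hA) ((aux_compl α _).2 hB))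
  simpa [compl_union] using this

theorem aux_up {X : Type u} [TopologicalSpace X] {α β : Ordinal.{0}} (h : β < α)
    {A : Set X} (hA : FunMul X β A) : FunAdd X α A := by
  have := FunAdd.union (X := X) α (ne_bot_of_gt h) (fun _ => β) (fun _ => h) (fun _ => A)
    (fun _ => hA)
  simpa [iUnion_const] using this

theorem aux_mono {X : Type u} [TopologicalSpace X] {α β : Ordinal.{0}} (h : β ≤ α)
    {A : Set X} (hA : FunAdd X β A) : FunAdd X α A := by
  rcases h.eq_or_lt with rfl | h
  · exact hA
  have h0 : α ≠ 0 := ne_bot_of_gt h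
  cases hA with
  | union _ h1 γ hγ s hs => exact FunAdd.union _ h0 γ (fun n => (hγ n).trans h) s hs
  | base _ hA =>
    obtain ⟨f, hf, hfI, rfl⟩ := hA
    have : f ⁻¹' (Ioc 0 1) = ⋃ n : ℕ, (fun x => max 0 (1 / ((n:ℝ) + 1) - f x)) ⁻¹' {0} := by
      ext x
      have h1 := hfI x
      simp only [mem_preimage, mem_Ioc, mem_iUnion, mem_singleton_iff, max_eq_left_iff, sub_nonpos]
      constructor
      · rintro ⟨h, _⟩
        obtain ⟨n, hn⟩ := exists_nat_one_div_lt h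
        exact ⟨n, hn.le⟩
      · rintro ⟨n, hn⟩
        exact ⟨lt_of_lt_of_le Nat.one_div_pos_of_nat hn, h1.2⟩
    rw [this]
    refine FunAdd.union _ h0 (fun _ => 0) (fun _ => h) _ fun n => FunMul.base _ ⟨_, ?_, ?_, rfl⟩
    · fun_prop
    · intro x
      have h1 := (hfI x).1
      have h2 : 1 / ((n:ℝ) + 1) ≤ 1 := by
        rw [div_le_one (by positivity)]
        linarith [Nat.cast_nonneg (α := ℝ) n]
      exact ⟨le_max_left _ _, max_le zero_le_one (by linarith)⟩

theorem aux_mmono {X : Type u} [TopologicalSpace X] {α β : Ordinal.{0}} (h : β ≤ α)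
    {A : Set X} (hA : FunMul X β A) : FunMul X α A := by
  simpa using (aux_compl α _).1 (aux_mono h ((aux_compl β _).2 hA))

theorem aux_inter {X : Type u} [TopologicalSpace X] {α : Ordinal.{0}} (h0 : α ≠ 0)
    {A B : Set X} (hA : FunAdd X α A) (hB : FunAdd X α B) : FunAdd X α (A ∩ B) := by
  obtain ⟨β, s, hβ, hs, rfl⟩ := aux_inv h0 hA
  obtain ⟨γ, t, hγ, ht, rfl⟩ := aux_inv h0 hB
  rw [iUnion_inter]
  refine aux_iUnion h0 _ fun n => ?_
  rw [inter_iUnion]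
  refine aux_iUnion h0 _ fun m => ?_
  exact aux_up (max_lt (hβ n) (hγ m)) (aux_minter (aux_mmono (le_max_left _ _) (hs n))
    (aux_mmono (le_max_right _ _) (ht m)))

theorem aux_empty {X : Type u} [TopologicalSpace X] (α : Ordinal.{0}) :
    FunAdd X α (∅ : Set X) :=
  aux_mono (zero_le (a := α)) (FunAdd.base _ ⟨fun _ => 0, continuous_const, by simp, by simp⟩)

theorem aux_univ {X : Type u} [TopologicalSpace X] (α : Ordinal.{0}) :
    FunAdd X α (univ : Set X) :=
  aux_mono (zero_le (a := α)) (FunAdd.base _ ⟨fun _ => 1, continuous_const, by simp, by simp⟩)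

theorem aux_red {X : Type u} [TopologicalSpace X] {α : Ordinal.{0}} (h0 : α ≠ 0)
    (G : ℕ → Set X) (hG : ∀ n, FunAdd X α (G n)) (hc : ∀ x, ∃ n, x ∈ G n) :
    ∃ h : X → ℕ, (∀ x, x ∈ G (h x)) ∧ ∀ S : Set ℕ, FunAdd X α (h ⁻¹' S) := by
  classical
  choose β s hβ hs hA using fun n => aux_inv h0 (hG n)
  have hF : ∀ x, ∃ i : ℕ, x ∈ s i.unpair.1 i.unpair.2 := by
    intro x
    obtain ⟨n, hn⟩ := hc x
    rw [hA, mem_iUnion] at hn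
    obtain ⟨k, hk⟩ := hn
    exact ⟨Nat.pair n k, by simpa using hk⟩
  have hpre : ∀ i : ℕ, FunAdd X α {x | ∀ j < i, x ∉ s j.unpair.1 j.unpair.2} := by
    intro i
    induction i with
    | zero => simpa using aux_univ α
    | succ i ih =>
      have : {x | ∀ j < i + 1, x ∉ s j.unpair.1 j.unpair.2} =
          {x | ∀ j < i, x ∉ s j.unpair.1 j.unpair.2} ∩ (s i.unpair.1 i.unpair.2)ᶜ := by
        ext x
        simp only [mem_setOf_eq, mem_inter_iff, mem_compl_iff, Nat.lt_succ_iff_lt_or_eq]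
        constructor
        · intro h; exact ⟨fun j hj => h j (Or.inl hj), h i (Or.inr rfl)⟩
        · rintro ⟨h1, h2⟩ j (hj | rfl)
          · exact h1 j hj
          · exact h2
      rw [this]
      exact aux_inter h0 ih (aux_mono (hβ _ _).le ((aux_compl _ _).2 (hs _ _)))
  refine ⟨fun x => (Nat.find (hF x)).unpair.1, fun x => ?_, fun S => ?_⟩
  · rw [hA, mem_iUnion]
    exact ⟨_, Nat.find_spec (hF x)⟩
  · have : (fun x => (Nat.find (hF x)).unpair.1) ⁻¹' S = ⋃ i : ℕ, if i.unpair.1 ∈ S then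
        s i.unpair.1 i.unpair.2 ∩ {x | ∀ j < i, x ∉ s j.unpair.1 j.unpair.2} else ∅ := by
      ext x
      simp only [mem_preimage, mem_iUnion]
      constructor
      · intro h
        refine ⟨Nat.find (hF x), ?_⟩
        rw [if_pos h]
        exact ⟨Nat.find_spec (hF x), fun j hj => Nat.find_min (hF x) hj⟩
      · rintro ⟨i, hi⟩
        split_ifs at hi with hS
        · have : Nat.find (hF x) = i := (Nat.find_eq_iff _).2 hi
          rw [this]; exact hS
        · exact hi.elim
    rw [this]
    refine aux_iUnion h0 _ fun i => ?_
    split_ifs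
    · exact aux_inter h0 (aux_up (hβ _ _) (hs _ _)) (hpre i)
    · exact aux_empty α

/-- any countable partition of a suitable `α`-embedded set `E` by functionally
ambiguous sets of class `α` in `E` extends to such a partition of the whole space. -/
theorem stmt18 {X : Type u} [TopologicalSpace X] (α : Ordinal.{0}) (hα0 : 0 < α)
    (hα : α < omega1) (E : Set X) (hE : AlphaEmbedded α E)
    (hsep : ∀ A : Set X, FunMul X α A → E ∩ A = ∅ → AlphaSeparated α E A)
    (A : ℕ → Set X) (hAE : ∀ n, A n ⊆ E)
    (hdisj : ∀ n m, n ≠ m → Disjoint (A n) (A m))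
    (hcover : (⋃ n, A n) = E)
    (hamb : ∀ n, FunAmbiguous ↥E α (Subtype.val ⁻¹' A n)) :
    ∃ B : ℕ → Set X, (∀ n m, n ≠ m → Disjoint (B n) (B m)) ∧ (⋃ n, B n) = Set.univ ∧
      (∀ n, FunAmbiguous X α (B n)) ∧ ∀ n, A n = E ∩ B n := by
  have h0 : α ≠ 0 := hα0.ne'
  have hC : ∀ n, ∃ C : Set X, FunAdd X α C ∧ A n = C ∩ E := by
    intro n
    obtain ⟨C, hC, h⟩ := hE.1 _ (hamb n).1
    refine ⟨C, hC, ?_⟩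
    rw [← h, Subtype.image_preimage_coe, inter_eq_right.2 (hAE n)]
  choose C hC hCE using hC
  obtain ⟨f, hf, hfE, hfU⟩ := hsep (⋃ n, C n)ᶜ ((aux_compl α _).1 (aux_iUnion h0 C hC)) (by
    rw [← disjoint_iff_inter_eq_empty, disjoint_compl_right_iff_subset, ← hcover]
    exact iUnion_mono fun n => by rw [hCE]; exact inter_subset_left)
  obtain ⟨h, hG, hS⟩ := aux_red h0 (fun n => C n ∪ f ⁻¹' {0}ᶜ)
    (fun n => aux_union (hC n) (hf.2 h0 _ isOpen_compl_singleton)) (by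
      intro x
      by_cases hx : x ∈ ⋃ n, C n
      · obtain ⟨n, hn⟩ := mem_iUnion.1 hx
        exact ⟨n, Or.inl hn⟩
      · have h1 : f x = 1 := hfU hx
        exact ⟨0, Or.inr (by simp [h1])⟩)
  have key : ∀ x ∈ E, x ∈ A (h x) := by
    intro x hx
    rcases hG x with h1 | h1
    · rw [hCE]; exact ⟨h1, hx⟩
    · exact absurd (hfE hx) h1
  refine ⟨fun n => h ⁻¹' {n}, ?_, ?_, ?_, ?_⟩
  · intro n m hnm
    exact Disjoint.preimage h (by simpa using hnm)
  · ext x; simp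
  · intro n
    refine ⟨hS _, ?_⟩
    simpa using (aux_compl α _).1 (hS {n}ᶜ)
  · intro n
    ext x
    constructor
    · intro hx
      refine ⟨hAE n hx, ?_⟩
      by_contra hne
      exact disjoint_left.1 (hdisj _ _ hne) (key x (hAE n hx)) hx
    · rintro ⟨hx, rfl⟩
      exact key x hx
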